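/- arXiv:1906.07120 — 4 statements merged into one kernel-verified Lean document; each statement's English description precedes it below -/
import Mathlib

section
/- Let μ, μ̃ ∈ P(E) and let Φ : E → [0, ∞) be measurable. Then the posterior measures μ_Φ(dx) := Z^{−1} exp(−Φ(x)) μ(dx) and μ̃_Φ(dx) := Z̃^{−1} exp(−Φ(x)) μ̃(dx), with Z := ∫_E exp(−Φ) dμ and Z̃ := ∫_E exp(−Φ) dμ̃, satisfy d_H(μ_Φ, μ̃_Φ) ≤ (2 / min(Z, Z̃)) · d_H(μ, μ̃). -/
open MeasureTheory Real

/-- The posterior measure `μ_Φ(dx) = Z⁻¹ exp(-Φ(x)) μ(dx)`. -/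
noncomputable def posterior {E : Type*} [MeasurableSpace E] (μ : Measure E) (Φ : E → ℝ) :
    Measure E :=
  (∫⁻ x, ENNReal.ofReal (Real.exp (-Φ x)) ∂μ)⁻¹ •
    μ.withDensity (fun x => ENNReal.ofReal (Real.exp (-Φ x)))

/-- The Hellinger distance between two measures, defined via Radon–Nikodym densities with
respect to the dominating measure `μ + ν`. -/
noncomputable def hellingerDist {E : Type*} [MeasurableSpace E] (μ ν : Measure E) : ℝ :=
  Real.sqrt (∫ x, (Real.sqrt ((μ.rnDeriv (μ + ν) x).toReal)
      - Real.sqrt ((ν.rnDeriv (μ + ν) x).toReal)) ^ 2 ∂(μ + ν))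

/-- The Hellinger distance may be computed with any dominating σ-finite measure. -/
theorem hellingerDist_eq_sqrt_integral_rnDeriv {E : Type*} [MeasurableSpace E]
    {μ ν η : Measure E} [IsFiniteMeasure μ] [IsFiniteMeasure ν] [SigmaFinite η]
    (hμ : μ ≪ η) (hν : ν ≪ η) :
    hellingerDist μ ν = √(∫ x, (√(μ.rnDeriv η x).toReal - √(ν.rnDeriv η x).toReal) ^ 2 ∂η) := by
  have hsum : μ + ν ≪ η := hμ.add_left hν
  have hμ' : μ ≪ μ + ν := Measure.AbsolutelyContinuous.rfl.add_right ν
  have hν' : ν ≪ μ + ν := by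
    rw [add_comm]
    exact Measure.AbsolutelyContinuous.rfl.add_right μ
  rw [hellingerDist, ← integral_rnDeriv_smul hsum]
  congr 1
  refine integral_congr_ae ?_
  filter_upwards [Measure.rnDeriv_mul_rnDeriv (κ := η) hμ',
    Measure.rnDeriv_mul_rnDeriv (κ := η) hν'] with x hx hy
  rw [← hx, ← hy]
  simp only [Pi.mul_apply, ENNReal.toReal_mul, smul_eq_mul]
  rw [Real.sqrt_mul ENNReal.toReal_nonneg, Real.sqrt_mul ENNReal.toReal_nonneg, ← sub_mul,
    mul_pow, Real.sq_sqrt ENNReal.toReal_nonneg, mul_comm]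

section Posterior

variable {E : Type*} [MeasurableSpace E] {μ : Measure E} {Φ : E → ℝ}

theorem integrable_exp_neg [IsFiniteMeasure μ] (hΦ : Measurable Φ) (hΦ0 : ∀ x, 0 ≤ Φ x) :
    Integrable (fun x => Real.exp (-Φ x)) μ :=
  Integrable.of_bound (by fun_prop) 1 (.of_forall fun x => by
    simpa [abs_of_pos (Real.exp_pos _)] using hΦ0 x)

theorem posterior_eq_ofReal_smul [IsFiniteMeasure μ] (hΦ : Measurable Φ) (hΦ0 : ∀ x, 0 ≤ Φ x) :
    posterior μ Φ = (ENNReal.ofReal (∫ x, Real.exp (-Φ x) ∂μ))⁻¹ •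
      μ.withDensity (fun x => ENNReal.ofReal (Real.exp (-Φ x))) := by
  rw [posterior, ofReal_integral_eq_lintegral_ofReal (integrable_exp_neg hΦ hΦ0)
    (.of_forall fun x => (Real.exp_pos _).le)]

theorem posterior_absolutelyContinuous : posterior μ Φ ≪ μ :=
  (withDensity_absolutelyContinuous μ _).smul_left _

theorem integral_exp_neg_pos [IsProbabilityMeasure μ] (hΦ : Measurable Φ)
    (hΦ0 : ∀ x, 0 ≤ Φ x) : 0 < ∫ x, Real.exp (-Φ x) ∂μ :=
  integral_exp_pos (integrable_exp_neg hΦ hΦ0)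

theorem integral_exp_neg_le_one [IsProbabilityMeasure μ] (hΦ : Measurable Φ)
    (hΦ0 : ∀ x, 0 ≤ Φ x) : ∫ x, Real.exp (-Φ x) ∂μ ≤ 1 := by
  calc ∫ x, Real.exp (-Φ x) ∂μ ≤ ∫ _, (1 : ℝ) ∂μ :=
        integral_mono (integrable_exp_neg hΦ hΦ0) (integrable_const 1)
          fun x => by simpa using hΦ0 x
    _ = 1 := by simp

theorem isFiniteMeasure_posterior [IsProbabilityMeasure μ] (hΦ : Measurable Φ)
    (hΦ0 : ∀ x, 0 ≤ Φ x) : IsFiniteMeasure (posterior μ Φ) := by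
  have := isFiniteMeasure_withDensity_ofReal (integrable_exp_neg (μ := μ) hΦ hΦ0).2
  rw [posterior_eq_ofReal_smul hΦ hΦ0]
  refine Measure.smul_finite _ ?_
  simpa using integral_exp_neg_pos hΦ hΦ0

theorem toReal_rnDeriv_posterior [IsProbabilityMeasure μ] {η : Measure E} [SigmaFinite η]
    (hΦ : Measurable Φ) (hΦ0 : ∀ x, 0 ≤ Φ x) :
    ∀ᵐ x ∂η, ((posterior μ Φ).rnDeriv η x).toReal =
      Real.exp (-Φ x) * (μ.rnDeriv η x).toReal / ∫ x, Real.exp (-Φ x) ∂μ := by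
  have hZ := integral_exp_neg_pos (μ := μ) hΦ hΦ0
  have := isFiniteMeasure_withDensity_ofReal (integrable_exp_neg (μ := μ) hΦ hΦ0).2
  rw [posterior_eq_ofReal_smul hΦ hΦ0]
  filter_upwards [Measure.rnDeriv_smul_left_of_ne_top
      (μ.withDensity fun x => ENNReal.ofReal (Real.exp (-Φ x))) η
      (r := (ENNReal.ofReal (∫ x, Real.exp (-Φ x) ∂μ))⁻¹) (by simpa using hZ),
    Measure.rnDeriv_withDensity_left (μ := μ) (ν := η)
      (f := fun x => ENNReal.ofReal (Real.exp (-Φ x))) (by fun_prop) (by simp)] with x hx hy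
  rw [hx, Pi.smul_apply, hy, smul_eq_mul, ENNReal.toReal_mul, ENNReal.toReal_mul,
    ENNReal.toReal_inv, ENNReal.toReal_ofReal hZ.le, ENNReal.toReal_ofReal (Real.exp_pos _).le]
  ring

end Posterior

/-- The squared `L²` distance of normalized functions is controlled by that of the functions. -/
theorem two_sub_div_sqrt_mul_sqrt_le {s t c D : ℝ} (hs : 0 < s) (ht : 0 < t) (hD : 0 ≤ D)
    (h : s + t - 2 * c ≤ D) : 2 - 2 * c / (√s * √t) ≤ D / min s t := by
  have ha := Real.sqrt_pos.2 hs
  have hb := Real.sqrt_pos.2 ht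
  have hm : min s t ≤ √s * √t := by
    rw [← Real.sqrt_mul hs.le]
    refine Real.le_sqrt_of_sq_le ?_
    rw [sq]
    exact mul_le_mul (min_le_left _ _) (min_le_right _ _) (lt_min hs ht).le hs.le
  calc 2 - 2 * c / (√s * √t) = (2 * (√s * √t) - 2 * c) / (√s * √t) := by field_simp
    _ ≤ D / (√s * √t) := by
      gcongr
      nlinarith [sq_nonneg (√s - √t), Real.sq_sqrt hs.le, Real.sq_sqrt ht.le]
    _ ≤ D / min s t := by
      have := lt_min hs ht
      gcongr

/-- Posteriors are Hellinger-stable in the prior, with the constant `1 / √(min Z Z̃)`. -/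
theorem hellingerDist_posterior_le_sqrt {E : Type*} [MeasurableSpace E]
    (μ ν : Measure E) [IsProbabilityMeasure μ] [IsProbabilityMeasure ν]
    {Φ : E → ℝ} (hΦ : Measurable Φ) (hΦ0 : ∀ x, 0 ≤ Φ x) :
    hellingerDist (posterior μ Φ) (posterior ν Φ) ≤
      hellingerDist μ ν / √(min (∫ x, Real.exp (-Φ x) ∂μ) (∫ x, Real.exp (-Φ x) ∂ν)) := by
  have hμ : μ ≪ μ + ν := Measure.AbsolutelyContinuous.rfl.add_right ν
  have hν : ν ≪ μ + ν := by
    rw [add_comm]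
    exact Measure.AbsolutelyContinuous.rfl.add_right μ
  have := isFiniteMeasure_posterior (μ := μ) hΦ hΦ0
  have := isFiniteMeasure_posterior (μ := ν) hΦ hΦ0
  have hs := integral_exp_neg_pos (μ := μ) hΦ hΦ0
  have ht := integral_exp_neg_pos (μ := ν) hΦ hΦ0
  have hpμ := toReal_rnDeriv_posterior (μ := μ) (η := μ + ν) hΦ hΦ0
  have hpν := toReal_rnDeriv_posterior (μ := ν) (η := μ + ν) hΦ hΦ0
  rw [hellingerDist_eq_sqrt_integral_rnDeriv (posterior_absolutelyContinuous.trans hμ)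
    (posterior_absolutelyContinuous.trans hν), hellingerDist,
    ← Real.sqrt_div (integral_nonneg fun x => sq_nonneg _)]
  refine Real.sqrt_le_sqrt ?_
  have hsf := integral_rnDeriv_smul (f := fun x => Real.exp (-Φ x)) hμ
  have htg := integral_rnDeriv_smul (f := fun x => Real.exp (-Φ x)) hν
  have hf : Integrable (fun x => (μ.rnDeriv (μ + ν) x).toReal) (μ + ν) :=
    Measure.integrable_toReal_rnDeriv
  have hg : Integrable (fun x => (ν.rnDeriv (μ + ν) x).toReal) (μ + ν) :=
    Measure.integrable_toReal_rnDeriv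
  have hfm : Measurable fun x => (μ.rnDeriv (μ + ν) x).toReal := by fun_prop
  have hgm : Measurable fun x => (ν.rnDeriv (μ + ν) x).toReal := by fun_prop
  have hf0 : ∀ x, 0 ≤ (μ.rnDeriv (μ + ν) x).toReal := fun _ => ENNReal.toReal_nonneg
  have hg0 : ∀ x, 0 ≤ (ν.rnDeriv (μ + ν) x).toReal := fun _ => ENNReal.toReal_nonneg
  generalize hfd : (fun x => (μ.rnDeriv (μ + ν) x).toReal) = f at *
  generalize hgd : (fun x => (ν.rnDeriv (μ + ν) x).toReal) = g at *
  simp only [fun x => congrFun hfd x, fun x => congrFun hgd x] at *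
  generalize (∫ x, Real.exp (-Φ x) ∂μ) = s at *
  generalize (∫ x, Real.exp (-Φ x) ∂ν) = t at *
  have hL1 : ∀ x, Real.exp (-Φ x) ≤ 1 := fun x => by simpa using hΦ0 x
  have hLb : ∀ᵐ x ∂(μ + ν), ‖Real.exp (-Φ x)‖ ≤ 1 :=
    .of_forall fun x => by simpa [abs_of_pos (Real.exp_pos _)] using hΦ0 x
  have hfg : Integrable (fun x => √(f x) * √(g x)) (μ + ν) := by
    refine (hf.add hg).mono' (by fun_prop) (.of_forall fun x => ?_)
    rw [Real.norm_of_nonneg (by positivity), Pi.add_apply]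
    nlinarith [sq_nonneg (√(f x) - √(g x)), Real.sq_sqrt (hf0 x), Real.sq_sqrt (hg0 x),
      sq_nonneg (√(f x)), sq_nonneg (√(g x))]
  have hsq : ∀ x, (√(f x) - √(g x)) ^ 2 = f x + g x - 2 * (√(f x) * √(g x)) := fun x => by
    rw [sub_sq, Real.sq_sqrt (hf0 x), Real.sq_sqrt (hg0 x)]
    ring
  have hLf := hf.bdd_mul (f := fun x => Real.exp (-Φ x)) (by fun_prop) hLb
  have hLg := hg.bdd_mul (f := fun x => Real.exp (-Φ x)) (by fun_prop) hLb
  have hLfg := hfg.bdd_mul (f := fun x => Real.exp (-Φ x)) (by fun_prop) hLb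
  simp only [smul_eq_mul, mul_comm (f _), mul_comm (g _)] at hsf htg
  have hpost : ∫ x, (√((posterior μ Φ).rnDeriv (μ + ν) x).toReal -
      √((posterior ν Φ).rnDeriv (μ + ν) x).toReal) ^ 2 ∂(μ + ν) =
      2 - 2 * (∫ x, Real.exp (-Φ x) * (√(f x) * √(g x)) ∂(μ + ν)) / (√s * √t) := by
    calc _ = ∫ x, (Real.exp (-Φ x) * f x / s + Real.exp (-Φ x) * g x / t -
          2 / (√s * √t) * (Real.exp (-Φ x) * (√(f x) * √(g x)))) ∂(μ + ν) := by
          refine integral_congr_ae ?_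
          filter_upwards [hpμ, hpν] with x hx hy
          have hL := Real.exp_pos (-Φ x)
          have hfx := hf0 x
          have hgx := hg0 x
          rw [hx, hy, sub_sq, Real.sq_sqrt (by positivity), Real.sq_sqrt (by positivity),
            Real.sqrt_div (by positivity), Real.sqrt_div (by positivity),
            Real.sqrt_mul hL.le, Real.sqrt_mul hL.le]
          linear_combination
            -(2 * √(f x) * √(g x) / (√s * √t)) * Real.sq_sqrt hL.le
      _ = _ := by
          rw [integral_sub ((hLf.div_const s).fun_add (hLg.div_const t)) (hLfg.const_mul _),
            integral_add (hLf.div_const s) (hLg.div_const t), integral_div, integral_div,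
            integral_const_mul, hsf, htg, div_self hs.ne', div_self ht.ne']
          ring
  rw [hpost]
  refine two_sub_div_sqrt_mul_sqrt_le hs ht (integral_nonneg fun x => sq_nonneg _) ?_
  calc _ = ∫ x, Real.exp (-Φ x) * (√(f x) - √(g x)) ^ 2 ∂(μ + ν) := by
        rw [← hsf, ← htg, ← integral_add hLf hLg, ← integral_const_mul,
          ← integral_sub (hLf.fun_add hLg) (hLfg.const_mul 2)]
        refine integral_congr_ae (.of_forall fun x => ?_)
        simp only [hsq]
        ring
    _ ≤ _ := by
        have hd : Integrable (fun x => (√(f x) - √(g x)) ^ 2) (μ + ν) := by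
          simp only [hsq]
          exact (hf.add hg).sub (hfg.const_mul 2)
        exact integral_mono (hd.bdd_mul (by fun_prop) hLb) hd
          fun x => mul_le_of_le_one_left (sq_nonneg _) (hL1 x)

theorem hellinger_stability_prior
    {E : Type*} [MetricSpace E] [CompleteSpace E] [TopologicalSpace.SeparableSpace E]
    [MeasurableSpace E] [BorelSpace E]
    (μ μt : Measure E) [IsProbabilityMeasure μ] [IsProbabilityMeasure μt]
    (Φ : E → ℝ) (hΦmeas : Measurable Φ) (hΦpos : ∀ x, 0 ≤ Φ x) :
    hellingerDist (posterior μ Φ) (posterior μt Φ) ≤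
      2 / min (∫ x, Real.exp (-Φ x) ∂μ) (∫ x, Real.exp (-Φ x) ∂μt) *
        hellingerDist μ μt := by
  refine (hellingerDist_posterior_le_sqrt μ μt hΦmeas hΦpos).trans ?_
  have hm : 0 < min (∫ x, Real.exp (-Φ x) ∂μ) (∫ x, Real.exp (-Φ x) ∂μt) :=
    lt_min (integral_exp_neg_pos hΦmeas hΦpos) (integral_exp_neg_pos hΦmeas hΦpos)
  have hm1 : min (∫ x, Real.exp (-Φ x) ∂μ) (∫ x, Real.exp (-Φ x) ∂μt) ≤ 1 :=
    (min_le_left _ _).trans (integral_exp_neg_le_one hΦmeas hΦpos)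
  have hd : 0 ≤ hellingerDist μ μt := Real.sqrt_nonneg _
  rw [div_mul_eq_mul_div]
  refine div_le_div₀ (by positivity) (by linarith) hm (Real.le_sqrt_of_sq_le ?_)
  nlinarith
end

section
/- Let μ, μ̃ ∈ P(E), let Φ : E → [0, ∞) be measurable with Z := ∫_E exp(−Φ) dμ, and let 0 ≤ r < Z/2. If d_H(μ, μ̃) ≤ r, then the posterior measures μ_Φ(dx) := Z^{−1} exp(−Φ(x)) μ(dx) and μ̃_Φ(dx) := Z̃^{−1} exp(−Φ(x)) μ̃(dx), with Z̃ := ∫_E exp(−Φ) dμ̃, satisfy d_H(μ_Φ, μ̃_Φ) ≤ (2 / (Z − 2r)) · d_H(μ, μ̃). -/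
open MeasureTheory Real

/-- The Hellinger distance may be computed with respect to any dominating measure. -/
theorem hellingerDist_withDensity {E : Type*} [MeasurableSpace E] (η : Measure E)
    [SigmaFinite η] {p q : E → ℝ} (hp : Measurable p) (hq : Measurable q)
    (hp0 : ∀ x, 0 ≤ p x) (hq0 : ∀ x, 0 ≤ q x) :
    hellingerDist (η.withDensity fun x => ENNReal.ofReal (p x))
        (η.withDensity fun x => ENNReal.ofReal (q x)) =
      Real.sqrt (∫ x, (Real.sqrt (p x) - Real.sqrt (q x)) ^ 2 ∂η) := by
  unfold hellingerDist
  set μ := η.withDensity fun x => ENNReal.ofReal (p x) with hμ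
  set ν := η.withDensity fun x => ENNReal.ofReal (q x) with hν
  have : SigmaFinite μ := SigmaFinite.withDensity_ofReal p
  have : SigmaFinite ν := SigmaFinite.withDensity_ofReal q
  have hsum : μ + ν = η.withDensity fun x => ENNReal.ofReal (p x + q x) := by
    rw [hμ, hν, ← withDensity_add_left hp.ennreal_ofReal]
    congr 1
    funext x
    exact (ENNReal.ofReal_add (hp0 x) (hq0 x)).symm
  have hpq : Measurable fun x => ENNReal.ofReal (p x + q x) := (hp.add hq).ennreal_ofReal
  have density_mul : ∀ (ρ : Measure E) (s : E → ℝ), SigmaFinite ρ → Measurable s →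
      (∀ x, 0 ≤ s x) → ρ = (η.withDensity fun x => ENNReal.ofReal (s x)) → ρ ≪ μ + ν →
      ∀ᵐ x ∂η, (p x + q x) * (ρ.rnDeriv (μ + ν) x).toReal = s x := by
    intro ρ s _ hs hs0 hρ hac
    have hF : Measurable (ρ.rnDeriv (μ + ν)) := Measure.measurable_rnDeriv _ _
    have h1 := Measure.withDensity_rnDeriv_eq ρ (μ + ν) hac
    generalize ρ.rnDeriv (μ + ν) = F at hF h1 ⊢
    rw [hsum, ← withDensity_mul η hpq hF, hρ,
      withDensity_eq_iff_of_sigmaFinite (hpq.mul hF).aemeasurable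
        hs.ennreal_ofReal.aemeasurable] at h1
    filter_upwards [h1] with x hx
    have := congrArg ENNReal.toReal hx
    simpa [ENNReal.toReal_mul, ENNReal.toReal_ofReal (add_nonneg (hp0 x) (hq0 x)),
      ENNReal.toReal_ofReal (hs0 x)] using this
  have hF := density_mul μ p inferInstance hp hp0 hμ
    (Measure.absolutelyContinuous_of_le (Measure.le_add_right le_rfl))
  have hG := density_mul ν q inferInstance hq hq0 hν
    (Measure.absolutelyContinuous_of_le (Measure.le_add_left le_rfl))
  generalize μ.rnDeriv (μ + ν) = F at hF ⊢
  generalize ν.rnDeriv (μ + ν) = G at hG ⊢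
  rw [hsum, integral_withDensity_eq_integral_toReal_smul hpq
    (Filter.Eventually.of_forall fun x => ENNReal.ofReal_lt_top)]
  congr 1
  refine integral_congr_ae ?_
  filter_upwards [hF, hG] with x hFx hGx
  have h0 := add_nonneg (hp0 x) (hq0 x)
  rw [ENNReal.toReal_ofReal h0, smul_eq_mul]
  have hsF := Real.sqrt_mul h0 (F x).toReal
  have hsG := Real.sqrt_mul h0 (G x).toReal
  rw [hFx] at hsF
  rw [hGx] at hsG
  rw [hsF, hsG, ← mul_sub, mul_pow, Real.sq_sqrt h0]

/-- The square of a difference of square roots is dominated by the sum. -/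
theorem sq_sqrt_sub_sqrt_le_add {a b : ℝ} (ha : 0 ≤ a) (hb : 0 ≤ b) :
    (Real.sqrt a - Real.sqrt b) ^ 2 ≤ a + b := by
  nlinarith [Real.sq_sqrt ha, Real.sq_sqrt hb, mul_nonneg (Real.sqrt_nonneg a) (Real.sqrt_nonneg b)]

theorem integrable_sq_sqrt_sub_sqrt {E : Type*} [MeasurableSpace E] {η : Measure E} {f g : E → ℝ}
    (hf : Integrable f η) (hg : Integrable g η) (hf0 : ∀ x, 0 ≤ f x) (hg0 : ∀ x, 0 ≤ g x) :
    Integrable (fun x => (Real.sqrt (f x) - Real.sqrt (g x)) ^ 2) η := by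
  refine (hf.add hg).mono' ?_ (Filter.Eventually.of_forall fun x => ?_)
  · exact ((Real.continuous_sqrt.comp_aestronglyMeasurable hf.1).sub
      (Real.continuous_sqrt.comp_aestronglyMeasurable hg.1)).pow 2
  · rw [Real.norm_of_nonneg (sq_nonneg _)]
    exact sq_sqrt_sub_sqrt_le_add (hf0 x) (hg0 x)

theorem integrable_sqrt_mul_sqrt {E : Type*} [MeasurableSpace E] {η : Measure E} {f g : E → ℝ}
    (hf : Integrable f η) (hg : Integrable g η) (hf0 : ∀ x, 0 ≤ f x) (hg0 : ∀ x, 0 ≤ g x) :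
    Integrable (fun x => Real.sqrt (f x) * Real.sqrt (g x)) η := by
  refine (hf.add hg).mono' ?_ (Filter.Eventually.of_forall fun x => ?_)
  · exact (Real.continuous_sqrt.comp_aestronglyMeasurable hf.1).mul
      (Real.continuous_sqrt.comp_aestronglyMeasurable hg.1)
  · rw [Real.norm_of_nonneg (by positivity), Pi.add_apply]
    nlinarith [Real.sq_sqrt (hf0 x), Real.sq_sqrt (hg0 x),
      sq_nonneg (Real.sqrt (f x) - Real.sqrt (g x)), hf0 x, hg0 x]

theorem integral_sq_smul_sqrt_sub_smul_sqrt {E : Type*} [MeasurableSpace E] {η : Measure E}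
    {f g : E → ℝ} (hf : Integrable f η) (hg : Integrable g η)
    (hf0 : ∀ x, 0 ≤ f x) (hg0 : ∀ x, 0 ≤ g x) (s t : ℝ) :
    ∫ x, (s * Real.sqrt (f x) - t * Real.sqrt (g x)) ^ 2 ∂η =
      s ^ 2 * ∫ x, f x ∂η + t ^ 2 * ∫ x, g x ∂η
        - 2 * s * t * ∫ x, Real.sqrt (f x) * Real.sqrt (g x) ∂η := by
  have hfg := integrable_sqrt_mul_sqrt hf hg hf0 hg0
  rw [← integral_const_mul, ← integral_const_mul, ← integral_const_mul,
    ← integral_add (hf.const_mul _) (hg.const_mul _),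
    ← integral_sub (by fun_prop) (hfg.const_mul _)]
  refine integral_congr_ae (Filter.Eventually.of_forall fun x => ?_)
  simp only
  linear_combination s ^ 2 * Real.sq_sqrt (hf0 x) + t ^ 2 * Real.sq_sqrt (hg0 x)

/-- Normalizing two vectors of norms `A`, `B` and inner product `c ≥ 0` is Lipschitz with
constant `2 / A`. -/
theorem normalized_sq_dist_le {A B c : ℝ} (hA : 0 < A) (hB : 0 < B) (hc0 : 0 ≤ c)
    (hc : c ≤ A * B) :
    2 - 2 * (c / (A * B)) ≤ 4 / A ^ 2 * (A ^ 2 + B ^ 2 - 2 * c) := by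
  obtain ⟨θ, rfl⟩ : ∃ θ, c = θ * (A * B) := ⟨c / (A * B), by field_simp⟩
  have hAB : 0 < A * B := mul_pos hA hB
  have hθ0 : 0 ≤ θ := nonneg_of_mul_nonneg_left hc0 hAB
  have hθ1 : θ ≤ 1 := by nlinarith
  rw [mul_div_cancel_right₀ _ hAB.ne', div_mul_eq_mul_div, le_div_iff₀ (by positivity)]
  nlinarith [mul_nonneg hθ0 (sq_nonneg (A - B)),
    mul_nonneg (sub_nonneg.2 hθ1) (sq_nonneg A), mul_nonneg (sub_nonneg.2 hθ1) (sq_nonneg B)]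

theorem integral_sq_sqrt_normalized_le {E : Type*} [MeasurableSpace E] {η : Measure E}
    {f g : E → ℝ} (hf : Integrable f η) (hg : Integrable g η)
    (hf0 : ∀ x, 0 ≤ f x) (hg0 : ∀ x, 0 ≤ g x)
    (hF : 0 < ∫ x, f x ∂η) (hG : 0 < ∫ x, g x ∂η) :
    ∫ x, (Real.sqrt ((∫ y, f y ∂η)⁻¹ * f x) - Real.sqrt ((∫ y, g y ∂η)⁻¹ * g x)) ^ 2 ∂η ≤
      4 / (∫ x, f x ∂η) * ∫ x, (Real.sqrt (f x) - Real.sqrt (g x)) ^ 2 ∂η := by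
  have key := integral_sq_smul_sqrt_sub_smul_sqrt hf hg hf0 hg0
  have hc0 : 0 ≤ ∫ x, Real.sqrt (f x) * Real.sqrt (g x) ∂η :=
    integral_nonneg fun x => by positivity
  generalize ∫ x, Real.sqrt (f x) * Real.sqrt (g x) ∂η = c at key hc0
  have h1 := key 1 1
  simp only [one_mul, one_pow, mul_one] at h1
  rw [h1]
  generalize ∫ x, f x ∂η = F at *
  generalize ∫ x, g x ∂η = G at *
  simp_rw [Real.sqrt_mul (inv_nonneg.2 hF.le), Real.sqrt_mul (inv_nonneg.2 hG.le), Real.sqrt_inv]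
  have hA := Real.sqrt_pos.2 hF
  have hB := Real.sqrt_pos.2 hG
  have hA2 := Real.sq_sqrt hF.le
  have hB2 := Real.sq_sqrt hG.le
  have h2 : ∫ x, ((Real.sqrt F)⁻¹ * Real.sqrt (f x) - (Real.sqrt G)⁻¹ * Real.sqrt (g x)) ^ 2 ∂η
      = 2 - 2 * (c / (Real.sqrt F * Real.sqrt G)) := by
    rw [key, inv_pow, inv_pow, hA2, hB2]
    field_simp
    ring
  have h3 : 0 ≤ 2 - 2 * (c / (Real.sqrt F * Real.sqrt G)) :=
    h2 ▸ integral_nonneg fun x => sq_nonneg _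
  rw [h2]
  have hc : c ≤ Real.sqrt F * Real.sqrt G := by
    rw [← div_le_one (mul_pos hA hB)]
    linarith
  simpa only [hA2, hB2] using normalized_sq_dist_le hA hB hc0 hc

/-- The density of the posterior with respect to a measure dominating the prior. -/
theorem posterior_withDensity {E : Type*} [MeasurableSpace E] (η : Measure E)
    {p Φ : E → ℝ} (hp : Measurable p) (hΦ : Measurable Φ) (hp0 : ∀ x, 0 ≤ p x)
    (hint : Integrable (fun x => Real.exp (-Φ x) * p x) η)
    (hpos : 0 < ∫ x, Real.exp (-Φ x) * p x ∂η) :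
    posterior (η.withDensity fun x => ENNReal.ofReal (p x)) Φ =
      η.withDensity fun x => ENNReal.ofReal
        ((∫ y, Real.exp (-Φ y) * p y ∂η)⁻¹ * (Real.exp (-Φ x) * p x)) := by
  have hw : Measurable fun x => ENNReal.ofReal (Real.exp (-Φ x)) :=
    (Real.measurable_exp.comp hΦ.neg).ennreal_ofReal
  have hmul : (fun x => ENNReal.ofReal (p x)) * (fun x => ENNReal.ofReal (Real.exp (-Φ x))) =
      fun x => ENNReal.ofReal (Real.exp (-Φ x) * p x) := by
    funext x
    rw [Pi.mul_apply, mul_comm, ENNReal.ofReal_mul (Real.exp_pos _).le]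
  unfold posterior
  rw [lintegral_withDensity_eq_lintegral_mul _ hp.ennreal_ofReal hw,
    ← withDensity_mul _ hp.ennreal_ofReal hw, hmul,
    ← ofReal_integral_eq_lintegral_ofReal hint
      (Filter.Eventually.of_forall fun x => mul_nonneg (Real.exp_pos _).le (hp0 x)),
    ← ENNReal.ofReal_inv_of_pos hpos, ← withDensity_smul' _ _ ENNReal.ofReal_ne_top]
  congr 1
  funext x
  rw [Pi.smul_apply, smul_eq_mul, ENNReal.ofReal_mul (inv_nonneg.2 hpos.le)]

theorem hellinger_local_lipschitz_prior
    {E : Type*} [MetricSpace E] [CompleteSpace E] [TopologicalSpace.SeparableSpace E]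
    [MeasurableSpace E] [BorelSpace E]
    (μ μt : Measure E) [IsProbabilityMeasure μ] [IsProbabilityMeasure μt]
    (Φ : E → ℝ) (hΦmeas : Measurable Φ) (hΦpos : ∀ x, 0 ≤ Φ x)
    (r : ℝ) (hr0 : 0 ≤ r) (hr : r < (∫ x, Real.exp (-Φ x) ∂μ) / 2)
    (hclose : hellingerDist μ μt ≤ r) :
    hellingerDist (posterior μ Φ) (posterior μt Φ) ≤
      2 / ((∫ x, Real.exp (-Φ x) ∂μ) - 2 * r) * hellingerDist μ μt := by
  obtain ⟨η, p, q, _, hp, hq, hp0, hq0, hpi, hqi, hμ, hμt⟩ :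
      ∃ (η : Measure E) (p q : E → ℝ), SigmaFinite η ∧ Measurable p ∧ Measurable q ∧
        (∀ x, 0 ≤ p x) ∧ (∀ x, 0 ≤ q x) ∧ Integrable p η ∧ Integrable q η ∧
        μ = (η.withDensity fun x => ENNReal.ofReal (p x)) ∧
        μt = (η.withDensity fun x => ENNReal.ofReal (q x)) := by
    have eq_withDensity : ∀ (ρ : Measure E), IsFiniteMeasure ρ → ρ ≪ μ + μt →
        ρ = (μ + μt).withDensity
          fun x => ENNReal.ofReal (ρ.rnDeriv (μ + μt) x).toReal := by
      intro ρ _ hρ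
      conv_lhs => rw [← Measure.withDensity_rnDeriv_eq ρ (μ + μt) hρ]
      refine withDensity_congr_ae ?_
      filter_upwards [ρ.rnDeriv_lt_top (μ + μt)] with x hx
      exact (ENNReal.ofReal_toReal hx.ne).symm
    exact ⟨μ + μt, fun x => (μ.rnDeriv (μ + μt) x).toReal,
      fun x => (μt.rnDeriv (μ + μt) x).toReal, inferInstance,
      (Measure.measurable_rnDeriv _ _).ennreal_toReal,
      (Measure.measurable_rnDeriv _ _).ennreal_toReal,
      fun _ => ENNReal.toReal_nonneg, fun _ => ENNReal.toReal_nonneg,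
      Measure.integrable_toReal_rnDeriv, Measure.integrable_toReal_rnDeriv,
      eq_withDensity μ inferInstance
        (Measure.absolutelyContinuous_of_le (Measure.le_add_right le_rfl)),
      eq_withDensity μt inferInstance
        (Measure.absolutelyContinuous_of_le (Measure.le_add_left le_rfl))⟩
  have hw0 : ∀ x, 0 ≤ Real.exp (-Φ x) := fun x => (Real.exp_pos _).le
  have hw1 : ∀ x, Real.exp (-Φ x) ≤ 1 := fun x => Real.exp_le_one_iff.2 (neg_nonpos.2 (hΦpos x))
  have hwm : Measurable fun x => Real.exp (-Φ x) := Real.measurable_exp.comp hΦmeas.neg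
  have hZ1 : ∫ x, Real.exp (-Φ x) ∂μ ≤ 1 := by
    have h := integral_mono_of_nonneg (μ := μ) (Filter.Eventually.of_forall hw0)
      (integrable_const (1 : ℝ)) (Filter.Eventually.of_forall hw1)
    simpa using h
  have weighted : ∀ s : E → ℝ, Measurable s → (∀ x, 0 ≤ s x) → Integrable s η →
      Integrable (fun x => Real.exp (-Φ x) * s x) η := by
    intro s hs hs0 hsi
    refine hsi.mono' (hwm.mul hs).aestronglyMeasurable (Filter.Eventually.of_forall fun x => ?_)
    rw [Real.norm_of_nonneg (mul_nonneg (hw0 x) (hs0 x))]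
    exact mul_le_of_le_one_left (hs0 x) (hw1 x)
  have hZ : ∫ x, Real.exp (-Φ x) ∂μ = ∫ x, Real.exp (-Φ x) * p x ∂η := by
    rw [hμ, integral_withDensity_eq_integral_toReal_smul hp.ennreal_ofReal
      (Filter.Eventually.of_forall fun x => ENNReal.ofReal_lt_top)]
    refine integral_congr_ae (Filter.Eventually.of_forall fun x => ?_)
    simp only [ENNReal.toReal_ofReal (hp0 x), smul_eq_mul, mul_comm]
  rw [hZ] at hr hZ1 ⊢
  have hfi := weighted p hp hp0 hpi
  have hgi := weighted q hq hq0 hqi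
  have hf0 : ∀ x, 0 ≤ Real.exp (-Φ x) * p x := fun x => mul_nonneg (hw0 x) (hp0 x)
  have hg0 : ∀ x, 0 ≤ Real.exp (-Φ x) * q x := fun x => mul_nonneg (hw0 x) (hq0 x)
  have hd : hellingerDist μ μt = Real.sqrt (∫ x, (Real.sqrt (p x) - Real.sqrt (q x)) ^ 2 ∂η) := by
    rw [hμ, hμt, hellingerDist_withDensity η hp hq hp0 hq0]
  have hd2 : hellingerDist μ μt ^ 2 = ∫ x, (Real.sqrt (p x) - Real.sqrt (q x)) ^ 2 ∂η := by
    rw [hd, Real.sq_sqrt (integral_nonneg fun x => sq_nonneg _)]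
  have hd0 : 0 ≤ hellingerDist μ μt := Real.sqrt_nonneg _
  have hweight : ∫ x, (Real.sqrt (Real.exp (-Φ x) * p x) - Real.sqrt (Real.exp (-Φ x) * q x)) ^ 2 ∂η
      ≤ hellingerDist μ μt ^ 2 := by
    rw [hd2]
    refine integral_mono (integrable_sq_sqrt_sub_sqrt hfi hgi hf0 hg0)
      (integrable_sq_sqrt_sub_sqrt hpi hqi hp0 hq0) fun x => ?_
    simp only
    rw [Real.sqrt_mul (hw0 x), Real.sqrt_mul (hw0 x), ← mul_sub, mul_pow, Real.sq_sqrt (hw0 x)]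
    exact mul_le_of_le_one_left (sq_nonneg _) (hw1 x)
  have hZpos : 0 < ∫ x, Real.exp (-Φ x) * p x ∂η := by linarith
  have hZtpos : 0 < ∫ x, Real.exp (-Φ x) * q x ∂η := by
    have h : ∫ x, Real.exp (-Φ x) * p x ∂η ≤ 2 * ∫ x, (Real.sqrt (Real.exp (-Φ x) * p x)
        - Real.sqrt (Real.exp (-Φ x) * q x)) ^ 2 ∂η + 2 * ∫ x, Real.exp (-Φ x) * q x ∂η := by
      have hi := integrable_sq_sqrt_sub_sqrt hfi hgi hf0 hg0
      rw [← integral_const_mul, ← integral_const_mul,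
        ← integral_add (hi.const_mul _) (hgi.const_mul _)]
      refine integral_mono hfi ((hi.const_mul _).add (hgi.const_mul _)) fun x => ?_
      simp only
      nlinarith [Real.sq_sqrt (hf0 x), Real.sq_sqrt (hg0 x),
        sq_nonneg (Real.sqrt (Real.exp (-Φ x) * p x) - 2 * Real.sqrt (Real.exp (-Φ x) * q x))]
    nlinarith
  have hpost : hellingerDist (posterior μ Φ) (posterior μt Φ) ≤
      Real.sqrt (4 / (∫ x, Real.exp (-Φ x) * p x ∂η) * hellingerDist μ μt ^ 2) := by
    conv_lhs => rw [hμ, hμt]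
    rw [posterior_withDensity η hp hΦmeas hp0 hfi hZpos,
      posterior_withDensity η hq hΦmeas hq0 hgi hZtpos,
      hellingerDist_withDensity η (by fun_prop) (by fun_prop)
        (fun x => mul_nonneg (inv_nonneg.2 hZpos.le) (hf0 x))
        (fun x => mul_nonneg (inv_nonneg.2 hZtpos.le) (hg0 x))]
    refine Real.sqrt_le_sqrt ((integral_sq_sqrt_normalized_le hfi hgi hf0 hg0 hZpos hZtpos).trans ?_)
    gcongr
  refine hpost.trans ?_
  generalize ∫ x, Real.exp (-Φ x) * p x ∂η = Z at *
  have hden : 0 < Z - 2 * r := by linarith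
  rw [Real.sqrt_le_left (by positivity), mul_pow, div_pow]
  have hsq : (Z - 2 * r) ^ 2 ≤ Z := by nlinarith
  gcongr
  norm_num
end

section
/- Let (E, d_E) be bounded with sup_{x,y ∈ E} d_E(x, y) ≤ D < ∞, let Φ : E → [0, ∞) be measurable such that exp(−Φ) : E → [0, 1] is Lipschitz with constant Lip(exp(−Φ)) < ∞ with respect to d_E, and let μ, μ̃ ∈ P(E). Then the posterior measures μ_Φ(dx) := Z^{−1} exp(−Φ(x)) μ(dx) and μ̃_Φ(dx) := Z̃^{−1} exp(−Φ(x)) μ̃(dx), with Z := ∫_E exp(−Φ) dμ and Z̃ := ∫_E exp(−Φ) dμ̃, satisfy W₁(μ_Φ, μ̃_Φ) ≤ ((1 + D·Lip(exp(−Φ))) / Z̃) · (1 + Lip(exp(−Φ)) · |μ|_{P¹} / Z) · W₁(μ, μ̃). -/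
open MeasureTheory ENNReal

/-- The 1-Wasserstein distance: infimum of `∫ d(x,y) dπ` over all couplings `π` of `μ` and `ν`. -/
noncomputable def wasserstein1 {E : Type*} [EDist E] [MeasurableSpace E]
    (μ ν : Measure E) : ℝ≥0∞ :=
  ⨅ (π : Measure (E × E)) (_ : π.map Prod.fst = μ) (_ : π.map Prod.snd = ν),
    ∫⁻ p, edist p.1 p.2 ∂π

/-- `|μ|_{P^q} = inf_{x₀} (∫ d(x,x₀)^q dμ)^{1/q}`. -/
noncomputable def ePnorm {E : Type*} [EDist E] [MeasurableSpace E] (q : ℝ) (μ : Measure E) :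
    ℝ≥0∞ :=
  ⨅ x₀ : E, (∫⁻ x, edist x x₀ ^ q ∂μ) ^ (1 / q)

section

variable {E : Type*} [MeasurableSpace E]

/-- Two densities with the same finite mass have the same excess mass over each other. -/
lemma lintegral_tsub_eq_of_lintegral_eq {π : Measure E} {A B : E → ℝ≥0∞}
    (hA : Measurable A) (hB : Measurable B)
    (hAB : ∫⁻ p, A p ∂π = ∫⁻ p, B p ∂π) (hfin : ∫⁻ p, A p ∂π ≠ ∞) :
    ∫⁻ p, (A p - B p) ∂π = ∫⁻ p, (B p - A p) ∂π := by
  have h₁ : ∫⁻ p, A p ∂π = ∫⁻ p, min (A p) (B p) ∂π + ∫⁻ p, (A p - B p) ∂π := by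
    rw [← lintegral_add_left (hA.min hB)]
    exact lintegral_congr fun p => by rw [add_comm, tsub_add_min]
  have h₂ : ∫⁻ p, B p ∂π = ∫⁻ p, min (A p) (B p) ∂π + ∫⁻ p, (B p - A p) ∂π := by
    rw [← lintegral_add_left (hA.min hB)]
    exact lintegral_congr fun p => by rw [min_comm, add_comm, tsub_add_min]
  have hmin : ∫⁻ p, min (A p) (B p) ∂π ≠ ∞ :=
    ne_top_of_le_ne_top hfin (lintegral_mono fun p => min_le_left _ _)
  exact (ENNReal.add_right_inj hmin).1 (h₁.symm.trans (hAB.trans h₂))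

/-- A normalized product of two measures of the same finite mass `r` has the given measures as
marginals. -/
lemma map_fst_snd_inv_smul_prod {F : Type*} [MeasurableSpace F] (α : Measure E) (β : Measure F)
    [IsFiniteMeasure α] [IsFiniteMeasure β] (h : α Set.univ = β Set.univ) :
    ((α Set.univ)⁻¹ • α.prod β).map Prod.fst = α ∧
      ((α Set.univ)⁻¹ • α.prod β).map Prod.snd = β := by
  rw [Measure.map_smul, Measure.map_smul, Measure.map_fst_prod, Measure.map_snd_prod, ← h, smul_smul, smul_smul]
  rcases eq_or_ne (α Set.univ) 0 with h0 | h0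
  · have hα : α = 0 := Measure.measure_univ_eq_zero.1 h0
    have hβ : β = 0 := Measure.measure_univ_eq_zero.1 (h ▸ h0)
    simp [hα, hβ]
  · rw [ENNReal.inv_mul_cancel h0 (measure_ne_top _ _)]
    simp

lemma map_withDensity_comp {F : Type*} [MeasurableSpace F] (π : Measure E) {T : E → F}
    (hT : Measurable T) {f : F → ℝ≥0∞} (hf : Measurable f) :
    (π.withDensity (fun p => f (T p))).map T = (π.map T).withDensity f := by
  ext s hs
  rw [Measure.map_apply hT hs, withDensity_apply _ (hT hs), withDensity_apply _ hs,
    setLIntegral_map hs hf hT]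

/-- Reweighting the two marginals of a coupling by densities `A` and `B` of the same mass:
transport the common mass `min A B` along the coupling, and the excess mass arbitrarily. -/
lemma wasserstein1_map_withDensity_le [EDist E] {D : ℝ≥0∞} (hD : ∀ x y : E, edist x y ≤ D)
    (hedist : Measurable fun p : E × E => edist p.1 p.2)
    (π : Measure (E × E)) {A B : E × E → ℝ≥0∞}
    (hA : Measurable A) (hB : Measurable B)
    (hAB : ∫⁻ p, A p ∂π = ∫⁻ p, B p ∂π) (hfin : ∫⁻ p, A p ∂π ≠ ∞) :
    wasserstein1 ((π.withDensity A).map Prod.fst) ((π.withDensity B).map Prod.snd) ≤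
      ∫⁻ p, B p * edist p.1 p.2 ∂π + D * ∫⁻ p, (A p - B p) ∂π := by
  have hsub := lintegral_tsub_eq_of_lintegral_eq hA hB hAB hfin
  have hrfin : ∫⁻ p, (A p - B p) ∂π ≠ ∞ :=
    ne_top_of_le_ne_top hfin (lintegral_mono fun p => tsub_le_self)
  set α := (π.withDensity fun p => A p - B p).map Prod.fst with hα
  set β := (π.withDensity fun p => B p - A p).map Prod.snd with hβ
  have hαr : α Set.univ = ∫⁻ p, (A p - B p) ∂π := by
    rw [hα, Measure.map_apply measurable_fst .univ]; simp
  have hβr : β Set.univ = ∫⁻ p, (A p - B p) ∂π := by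
    rw [hβ, Measure.map_apply measurable_snd .univ]; simp [hsub]
  have : IsFiniteMeasure α := ⟨by rw [hαr]; exact hrfin.lt_top⟩
  have : IsFiniteMeasure β := ⟨by rw [hβr]; exact hrfin.lt_top⟩
  obtain ⟨hfst, hsnd⟩ := map_fst_snd_inv_smul_prod α β (hαr.trans hβr.symm)
  have hmin : Measurable fun p => min (A p) (B p) := hA.min hB
  refine (iInf₂_le_of_le (π.withDensity (fun p => min (A p) (B p)) +
    (α Set.univ)⁻¹ • α.prod β) ?_ (iInf_le_of_le ?_ ?_))
  · rw [Measure.map_add _ _ measurable_fst, hfst, hα, ← Measure.map_add _ _ measurable_fst,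
      ← withDensity_add_left hmin]
    congr 2
    ext p
    simp only [Pi.add_apply]
    rw [add_comm, tsub_add_min]
  · rw [Measure.map_add _ _ measurable_snd, hsnd, hβ, ← Measure.map_add _ _ measurable_snd,
      ← withDensity_add_left hmin]
    congr 2
    ext p
    simp only [Pi.add_apply]
    rw [min_comm, add_comm, tsub_add_min]
  · rw [lintegral_add_measure, lintegral_smul_measure,
      lintegral_withDensity_eq_lintegral_mul _ hmin hedist]
    simp only [Pi.mul_apply]
    gcongr
    · exact min_le_right _ _
    · calc (α Set.univ)⁻¹ • ∫⁻ p, edist p.1 p.2 ∂α.prod β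
          ≤ (α Set.univ)⁻¹ * ∫⁻ _, D ∂α.prod β :=
            mul_le_mul_right (lintegral_mono fun p : E × E => hD p.1 p.2) _
        _ = ((α Set.univ)⁻¹ * α Set.univ) * (D * β Set.univ) := by
            rw [lintegral_const, ← Set.univ_prod_univ, Measure.prod_prod]; ring
        _ ≤ 1 * (D * β Set.univ) := by
            gcongr
            exact ENNReal.inv_mul_le_one _
        _ = D * ∫⁻ p, (A p - B p) ∂π := by rw [one_mul, hβr]

/-- Stability of the normalized reweighting of a coupling by a Lipschitz density `g ≤ 1`. -/
lemma wasserstein1_inv_smul_withDensity_le [PseudoEMetricSpace E] {D : ℝ≥0∞}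
    (hD : ∀ x y : E, edist x y ≤ D) (hedist : Measurable fun p : E × E => edist p.1 p.2)
    {g : E → ℝ≥0∞} (hg : Measurable g) (hg1 : ∀ x, g x ≤ 1) {L : ℝ≥0∞}
    (hgL : ∀ x y, g x ≤ g y + L * edist x y) (π : Measure (E × E)) {μ ν : Measure E}
    (hμ : π.map Prod.fst = μ) (hν : π.map Prod.snd = ν) {Z Zt : ℝ≥0∞}
    (hZ : ∫⁻ x, g x ∂μ = Z) (hZt : ∫⁻ x, g x ∂ν = Zt) (hZ0 : Z ≠ 0) (hZtop : Z ≠ ∞)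
    (hZt0 : Zt ≠ 0) (hZttop : Zt ≠ ∞) :
    wasserstein1 (Z⁻¹ • μ.withDensity g) (Zt⁻¹ • ν.withDensity g) ≤
      (1 + D * L) * Zt⁻¹ * ∫⁻ p, edist p.1 p.2 ∂π := by
  set A : E × E → ℝ≥0∞ := fun p => Z⁻¹ * g p.1
  set B : E × E → ℝ≥0∞ := fun p => Zt⁻¹ * g p.2
  have hA : Measurable A := (hg.comp measurable_fst).const_mul _
  have hB : Measurable B := (hg.comp measurable_snd).const_mul _
  have hIA : ∫⁻ p, A p ∂π = 1 := by
    simp only [A]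
    rw [lintegral_const_mul _ (by fun_prop), ← lintegral_map hg measurable_fst, hμ, hZ,
      ENNReal.inv_mul_cancel hZ0 hZtop]
  have hIB : ∫⁻ p, B p ∂π = 1 := by
    simp only [B]
    rw [lintegral_const_mul _ (by fun_prop), ← lintegral_map hg measurable_snd, hν, hZt,
      ENNReal.inv_mul_cancel hZt0 hZttop]
  have hAB : ∫⁻ p, A p ∂π = ∫⁻ p, B p ∂π := hIA.trans hIB.symm
  have hfin : ∫⁻ p, A p ∂π ≠ ∞ := by simp [hIA]
  have hmA : (π.withDensity A).map Prod.fst = Z⁻¹ • μ.withDensity g := by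
    rw [← withDensity_smul _ hg, ← hμ,
      ← map_withDensity_comp π measurable_fst (hg.const_smul Z⁻¹)]
    rfl
  have hmB : (π.withDensity B).map Prod.snd = Zt⁻¹ • ν.withDensity g := by
    rw [← withDensity_smul _ hg, ← hν,
      ← map_withDensity_comp π measurable_snd (hg.const_smul Zt⁻¹)]
    rfl
  have hkey : ∫⁻ p, (A p - B p) ∂π ≤ Zt⁻¹ * L * ∫⁻ p, edist p.1 p.2 ∂π := by
    rw [← lintegral_const_mul _ hedist]
    rcases le_total Zt Z with h | h
    · refine lintegral_mono fun p => tsub_le_iff_left.2 ?_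
      calc Z⁻¹ * g p.1 ≤ Zt⁻¹ * (g p.2 + L * edist p.1 p.2) := by
            gcongr
            exact hgL _ _
        _ = B p + Zt⁻¹ * L * edist p.1 p.2 := by ring
    · rw [lintegral_tsub_eq_of_lintegral_eq hA hB hAB hfin]
      refine lintegral_mono fun p => tsub_le_iff_left.2 ?_
      calc Zt⁻¹ * g p.2 ≤ Zt⁻¹ * (g p.1 + L * edist p.2 p.1) := by
            gcongr
            exact hgL _ _
        _ = Zt⁻¹ * g p.1 + Zt⁻¹ * L * edist p.1 p.2 := by rw [edist_comm]; ring
        _ ≤ A p + Zt⁻¹ * L * edist p.1 p.2 := by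
            gcongr
            exact mul_le_mul_left (ENNReal.inv_le_inv.2 h) _
  rw [← hmA, ← hmB]
  calc _ ≤ ∫⁻ p, B p * edist p.1 p.2 ∂π + D * ∫⁻ p, (A p - B p) ∂π :=
        wasserstein1_map_withDensity_le hD hedist π hA hB hAB hfin
    _ ≤ ∫⁻ p, Zt⁻¹ * edist p.1 p.2 ∂π + D * (Zt⁻¹ * L * ∫⁻ p, edist p.1 p.2 ∂π) := by
        gcongr with p
        exact mul_le_of_le_one_right' (hg1 p.2)
    _ = (1 + D * L) * Zt⁻¹ * ∫⁻ p, edist p.1 p.2 ∂π := by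
        rw [lintegral_const_mul _ hedist]; ring

end

theorem wasserstein_stability_prior
    {E : Type*} [MetricSpace E] [CompleteSpace E] [TopologicalSpace.SeparableSpace E]
    [MeasurableSpace E] [BorelSpace E] [Nonempty E]
    (D : ℝ) (hD : ∀ x y : E, dist x y ≤ D)
    (Φ : E → ℝ) (hΦmeas : Measurable Φ) (hΦpos : ∀ x, 0 ≤ Φ x)
    (L : NNReal) (hLip : LipschitzWith L (fun x => Real.exp (-Φ x)))
    (μ μt : Measure E) [IsProbabilityMeasure μ] [IsProbabilityMeasure μt] :
    wasserstein1 (posterior μ Φ) (posterior μt Φ) ≤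
      ENNReal.ofReal ((1 + D * L) / (∫ x, Real.exp (-Φ x) ∂μt) *
          (1 + L * (⨅ x₀ : E, ∫ x, dist x x₀ ∂μ) / (∫ x, Real.exp (-Φ x) ∂μ))) *
        wasserstein1 μ μt := by
  have : SecondCountableTopology E := UniformSpace.secondCountable_of_separable E
  have hD0 : 0 ≤ D := dist_nonneg.trans (hD (Classical.arbitrary E) (Classical.arbitrary E))
  have hle1 : ∀ x, Real.exp (-Φ x) ≤ 1 := fun x => Real.exp_le_one_iff.2 (by simp [hΦpos x])
  have hmeas : Measurable fun x => Real.exp (-Φ x) := hΦmeas.neg.exp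
  have hint : ∀ ν : Measure E, IsProbabilityMeasure ν →
      Integrable (fun x => Real.exp (-Φ x)) ν := fun ν _ =>
    .of_bound hmeas.aestronglyMeasurable 1 <| .of_forall fun x => by
      simpa [abs_of_pos (Real.exp_pos _)] using hΦpos x
  have hZpos : ∀ ν : Measure E, IsProbabilityMeasure ν → 0 < ∫ x, Real.exp (-Φ x) ∂ν :=
    fun ν hν => integral_exp_pos (hint ν hν)
  have hZeq : ∀ ν : Measure E, IsProbabilityMeasure ν →
      ∫⁻ x, ENNReal.ofReal (Real.exp (-Φ x)) ∂ν = ENNReal.ofReal (∫ x, Real.exp (-Φ x) ∂ν) :=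
    fun ν hν => (ofReal_integral_eq_lintegral_ofReal (hint ν hν)
      (.of_forall fun x => (Real.exp_pos _).le)).symm
  set Z := ∫ x, Real.exp (-Φ x) ∂μ
  set Zt := ∫ x, Real.exp (-Φ x) ∂μt
  have hZ : 0 < Z := hZpos μ inferInstance
  have hZt : 0 < Zt := hZpos μt inferInstance
  have hgL : ∀ x y, ENNReal.ofReal (Real.exp (-Φ x)) ≤
      ENNReal.ofReal (Real.exp (-Φ y)) + (L : ℝ≥0∞) * edist x y := by
    intro x y
    rw [edist_dist, ← ENNReal.ofReal_coe_nnreal, ← ENNReal.ofReal_mul L.coe_nonneg,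
      ← ENNReal.ofReal_add (Real.exp_pos _).le (by positivity)]
    exact ENNReal.ofReal_le_ofReal (hLip.le_add_mul x y)
  set m := ⨅ x₀ : E, ∫ x, dist x x₀ ∂μ
  have hm : 0 ≤ m := Real.iInf_nonneg fun x₀ => integral_nonneg fun x => dist_nonneg
  have hC : (1 + ENNReal.ofReal D * L) * (ENNReal.ofReal Zt)⁻¹ ≤
      ENNReal.ofReal ((1 + D * L) / Zt * (1 + L * m / Z)) := by
    rw [← ENNReal.ofReal_coe_nnreal, ← ENNReal.ofReal_mul hD0, ← ENNReal.ofReal_one,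
      ← ENNReal.ofReal_add zero_le_one (by positivity), ← ENNReal.ofReal_inv_of_pos hZt,
      ← ENNReal.ofReal_mul (by positivity), ← div_eq_mul_inv]
    refine ENNReal.ofReal_le_ofReal (le_mul_of_one_le_right (by positivity) ?_)
    have : 0 ≤ L * m / Z := by positivity
    linarith
  have hCpos : 0 < (1 + D * L) / Zt * (1 + L * m / Z) := by positivity
  have hC0 := (ENNReal.ofReal_pos.2 hCpos).ne'
  rw [mul_comm, ← ENNReal.div_le_iff_le_mul (.inl hC0) (.inl ofReal_ne_top)]
  refine le_iInf fun π => le_iInf₂ fun hμ hν => ?_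
  rw [ENNReal.div_le_iff_le_mul (.inl hC0) (.inl ofReal_ne_top), mul_comm]
  refine le_trans ?_ (mul_le_mul_left hC _)
  unfold posterior
  rw [hZeq μ inferInstance, hZeq μt inferInstance]
  refine wasserstein1_inv_smul_withDensity_le
    (fun x y => by rw [edist_dist]; exact ENNReal.ofReal_le_ofReal (hD x y)) measurable_edist
    hmeas.ennreal_ofReal (fun x => ENNReal.ofReal_le_one.2 (hle1 x)) hgL π hμ hν
    (hZeq μ inferInstance) (hZeq μt inferInstance) ?_ ofReal_ne_top ?_ ofReal_ne_top
  · exact (ENNReal.ofReal_pos.2 hZ).ne'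
  · exact (ENNReal.ofReal_pos.2 hZt).ne'
end

section
/- Let q ≥ 1, let Φ : E → [0, ∞) be continuous, let μ ∈ P^q(E), and let (μ̃^(k))_{k∈ℕ} be a sequence in P^q(E). Define μ_Φ(dx) := Z^{−1} exp(−Φ(x)) μ(dx) with Z := ∫_E exp(−Φ) dμ and, for each k, μ̃_Φ^(k)(dx) := Z̃_k^{−1} exp(−Φ(x)) μ̃^(k)(dx) with Z̃_k := ∫_E exp(−Φ) dμ̃^(k). If W_q(μ, μ̃^(k)) → 0 as k → ∞, then W_q(μ_Φ, μ̃_Φ^(k)) → 0 as k → ∞. -/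
open MeasureTheory ENNReal Filter

/-- The q-Wasserstein distance: infimum of `(∫ d(x,y)^q dπ)^{1/q}` over all couplings `π`
of `μ` and `ν`. -/
noncomputable def wassersteinDist {E : Type*} [EDist E] [MeasurableSpace E]
    (q : ℝ) (μ ν : Measure E) : ℝ≥0∞ :=
  ⨅ (π : Measure (E × E)) (_ : π.map Prod.fst = μ) (_ : π.map Prod.snd = ν),
    (∫⁻ p, edist p.1 p.2 ^ q ∂π) ^ (1 / q)

/-- Two measures with densities `a` and `b` with respect to the marginals of `π` are coupled by
keeping the common mass `min (a x) (b y)` of `π` and coupling the remaining mass independently. -/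
lemma wassersteinDist_withDensity_rpow_le {E : Type*} [PseudoEMetricSpace E] [SecondCountableTopology E]
    [MeasurableSpace E] [BorelSpace E] {q : ℝ} (hq : 1 ≤ q) {π : Measure (E × E)}
    {a b : E → ℝ≥0∞} (ha : Measurable a) (hb : Measurable b)
    (ha_one : ∫⁻ p, a p.1 ∂π = 1) (hb_one : ∫⁻ p, b p.2 ∂π = 1) (x₀ : E) :
    wassersteinDist q ((π.map Prod.fst).withDensity a) ((π.map Prod.snd).withDensity b) ^ q ≤
      ∫⁻ p, edist p.1 p.2 ^ q * a p.1 ∂π +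
        2 ^ (q - 1) * (∫⁻ p, edist p.1 x₀ ^ q * (a p.1 - b p.2) ∂π +
          ∫⁻ p, edist p.2 x₀ ^ q * (b p.2 - a p.1) ∂π) := by
  have hq0 : 0 < q := by linarith
  have ha' : Measurable fun p : E × E => a p.1 := ha.comp measurable_fst
  have hb' : Measurable fun p : E × E => b p.2 := hb.comp measurable_snd
  have hfst : Measurable fun p : E × E => edist p.1 x₀ ^ q := by fun_prop
  have hsnd : Measurable fun p : E × E => edist p.2 x₀ ^ q := by fun_prop
  have hx₀ : Measurable fun x : E => edist x x₀ ^ q := by fun_prop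
  have hdist : Measurable fun p : E × E => edist p.1 p.2 ^ q := by fun_prop
  have hmin : Measurable fun p : E × E => min (a p.1) (b p.2) := ha'.min hb'
  have hab : Measurable fun p : E × E => a p.1 - b p.2 := ha'.sub hb'
  have hba : Measurable fun p : E × E => b p.2 - a p.1 := hb'.sub ha'
  set m := π.withDensity fun p => min (a p.1) (b p.2) with hm
  set α := (π.withDensity fun p => a p.1 - b p.2).map Prod.fst with hα
  set β := (π.withDensity fun p => b p.2 - a p.1).map Prod.snd with hβ
  set δ := α Set.univ with hδ
  have hα_univ : δ = ∫⁻ p, (a p.1 - b p.2) ∂π := by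
    rw [hδ, hα, Measure.map_apply measurable_fst .univ]
    simp
  have hβ_univ : β Set.univ = ∫⁻ p, (b p.2 - a p.1) ∂π := by
    rw [hβ, Measure.map_apply measurable_snd .univ]
    simp
  have hδ_ne_top : δ ≠ ⊤ := by
    refine ne_top_of_le_ne_top one_ne_top ?_
    rw [hα_univ, ← ha_one]
    exact lintegral_mono fun p => tsub_le_self
  have hβδ : β Set.univ = δ := by
    have hmin_ne_top : ∫⁻ p, min (a p.1) (b p.2) ∂π ≠ ⊤ := by
      refine ne_top_of_le_ne_top one_ne_top ?_
      rw [← ha_one]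
      exact lintegral_mono fun p => min_le_left _ _
    have h1 : δ + ∫⁻ p, min (a p.1) (b p.2) ∂π = 1 := by
      rw [hα_univ, ← lintegral_add_left hab, ← ha_one]
      simp only [tsub_add_min]
    have h2 : β Set.univ + ∫⁻ p, min (a p.1) (b p.2) ∂π = 1 := by
      rw [hβ_univ, ← lintegral_add_left hba, ← hb_one]
      simp only [min_comm (a _), tsub_add_min]
    exact (ENNReal.add_left_inj hmin_ne_top).1 (h2.trans h1.symm)
  have : IsFiniteMeasure α := ⟨hδ_ne_top.lt_top⟩
  have : IsFiniteMeasure β := ⟨by rw [hβδ]; exact hδ_ne_top.lt_top⟩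
  have hδ_smul : ∀ κ : Measure E, κ Set.univ = δ → δ⁻¹ • δ • κ = κ := by
    intro κ hκ
    rcases eq_or_ne δ 0 with h0 | h0
    · rw [h0, Measure.measure_univ_eq_zero] at hκ
      simp [hκ]
    · rw [smul_smul, ENNReal.inv_mul_cancel h0 hδ_ne_top, one_smul]
  have hρ_fst : (m + δ⁻¹ • α.prod β).map Prod.fst = (π.map Prod.fst).withDensity a := by
    rw [Measure.map_add _ _ measurable_fst, Measure.map_smul, Measure.map_fst_prod, hβδ,
      hδ_smul α rfl, hm, hα, ← Measure.map_add _ _ measurable_fst, ← withDensity_add_left hmin]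
    ext s hs
    rw [Measure.map_apply measurable_fst hs, withDensity_apply _ (measurable_fst hs),
      withDensity_apply _ hs, setLIntegral_map hs ha measurable_fst]
    simp only [Pi.add_apply, add_comm (min _ _), tsub_add_min]
  have hρ_snd : (m + δ⁻¹ • α.prod β).map Prod.snd = (π.map Prod.snd).withDensity b := by
    rw [Measure.map_add _ _ measurable_snd, Measure.map_smul, Measure.map_snd_prod, ← hδ,
      hδ_smul β hβδ, hm, hβ, ← Measure.map_add _ _ measurable_snd, ← withDensity_add_left hmin]
    ext s hs
    rw [Measure.map_apply measurable_snd hs, withDensity_apply _ (measurable_snd hs),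
      withDensity_apply _ hs, setLIntegral_map hs hb measurable_snd]
    simp only [Pi.add_apply, add_comm (min _ _), min_comm (a _), tsub_add_min]
  have hW : wassersteinDist q ((π.map Prod.fst).withDensity a)
      ((π.map Prod.snd).withDensity b) ^ q ≤
        ∫⁻ p, edist p.1 p.2 ^ q ∂(m + δ⁻¹ • α.prod β) := by
    have hle : wassersteinDist q ((π.map Prod.fst).withDensity a)
        ((π.map Prod.snd).withDensity b) ≤
          (∫⁻ p, edist p.1 p.2 ^ q ∂(m + δ⁻¹ • α.prod β)) ^ (1 / q) :=
      iInf_le_of_le _ (iInf_le_of_le hρ_fst (iInf_le_of_le hρ_snd le_rfl))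
    refine (ENNReal.rpow_le_rpow hle hq0.le).trans_eq ?_
    rw [← ENNReal.rpow_mul, one_div_mul_cancel hq0.ne', ENNReal.rpow_one]
  have hprod : ∫⁻ p, edist p.1 p.2 ^ q ∂(α.prod β) ≤
      2 ^ (q - 1) * (δ * ∫⁻ x, edist x x₀ ^ q ∂α + δ * ∫⁻ y, edist y x₀ ^ q ∂β) := by
    calc ∫⁻ p, edist p.1 p.2 ^ q ∂(α.prod β)
        ≤ ∫⁻ p, 2 ^ (q - 1) * (edist p.1 x₀ ^ q + edist p.2 x₀ ^ q) ∂(α.prod β) :=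
          lintegral_mono fun p => (ENNReal.rpow_le_rpow (edist_triangle_right _ _ x₀) hq0.le).trans
            (ENNReal.rpow_add_le_mul_rpow_add_rpow _ _ hq)
      _ = 2 ^ (q - 1) * (∫⁻ p, edist p.1 x₀ ^ q ∂(α.prod β) +
            ∫⁻ p, edist p.2 x₀ ^ q ∂(α.prod β)) := by
          rw [lintegral_const_mul _ (by fun_prop), lintegral_add_left hfst]
      _ = _ := by
          rw [← lintegral_map (g := Prod.fst) hx₀ measurable_fst,
            ← lintegral_map (g := Prod.snd) hx₀ measurable_snd,
            Measure.map_fst_prod, Measure.map_snd_prod, lintegral_smul_measure,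
            lintegral_smul_measure, hβδ, ← hδ]
          simp
  have hα_int : ∫⁻ x, edist x x₀ ^ q ∂α = ∫⁻ p, edist p.1 x₀ ^ q * (a p.1 - b p.2) ∂π := by
    rw [hα, lintegral_map hx₀ measurable_fst, lintegral_withDensity_eq_lintegral_mul _ hab hfst]
    simp [mul_comm]
  have hβ_int : ∫⁻ y, edist y x₀ ^ q ∂β = ∫⁻ p, edist p.2 x₀ ^ q * (b p.2 - a p.1) ∂π := by
    rw [hβ, lintegral_map hx₀ measurable_snd, lintegral_withDensity_eq_lintegral_mul _ hba hsnd]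
    simp [mul_comm]
  have hm_int : ∫⁻ p, edist p.1 p.2 ^ q ∂m ≤ ∫⁻ p, edist p.1 p.2 ^ q * a p.1 ∂π := by
    rw [hm, lintegral_withDensity_eq_lintegral_mul _ hmin hdist]
    refine lintegral_mono fun p => ?_
    rw [Pi.mul_apply, mul_comm]
    gcongr
    exact min_le_left _ _
  refine hW.trans ?_
  rw [lintegral_add_measure, lintegral_smul_measure, smul_eq_mul, ← hα_int, ← hβ_int]
  refine add_le_add hm_int ?_
  calc δ⁻¹ * ∫⁻ p, edist p.1 p.2 ^ q ∂(α.prod β)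
      ≤ δ⁻¹ * (2 ^ (q - 1) * (δ * ∫⁻ x, edist x x₀ ^ q ∂α + δ * ∫⁻ y, edist y x₀ ^ q ∂β)) := by
        gcongr
    _ = δ⁻¹ * δ * (2 ^ (q - 1) * (∫⁻ x, edist x x₀ ^ q ∂α + ∫⁻ y, edist y x₀ ^ q ∂β)) := by ring
    _ ≤ 1 * (2 ^ (q - 1) * (∫⁻ x, edist x x₀ ^ q ∂α + ∫⁻ y, edist y x₀ ^ q ∂β)) := by
        gcongr
        exact ENNReal.inv_mul_le_one δ
    _ = _ := one_mul _

/-- If `π k` are measures with a common first marginal `μ` that concentrate on the diagonal, then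
the `μ`-weighted mean oscillation of a continuous function with values in a set of diameter at
most one vanishes in the limit. -/
lemma tendsto_lintegral_mul_edist_comp {E : Type*} [PseudoEMetricSpace E] [SecondCountableTopology E]
    [MeasurableSpace E] [BorelSpace E] {μ : Measure E}
    {f : E → ℝ} (hf : Continuous f) (hf_le : ∀ x y, edist (f x) (f y) ≤ 1)
    {h : E → ℝ≥0∞} (hh : Measurable h) (hh_int : ∫⁻ x, h x ∂μ ≠ ⊤) (hh_top : ∀ x, h x ≠ ⊤)
    {π : ℕ → Measure (E × E)} (hπ : ∀ k, (π k).map Prod.fst = μ)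
    (hπ_diag : ∀ δ : ℝ≥0∞, δ ≠ 0 → δ ≠ ⊤ →
      Tendsto (fun k => π k {p | δ ≤ edist p.1 p.2}) atTop (nhds 0)) :
    Tendsto (fun k => ∫⁻ p, h p.1 * edist (f p.1) (f p.2) ∂(π k)) atTop (nhds 0) := by
  rw [ENNReal.tendsto_nhds_zero]
  intro ε hε
  have hε4 : ε / 4 ≠ 0 := (ENNReal.div_pos hε.ne' (by norm_num)).ne'
  obtain ⟨c, hc, hcε⟩ := ENNReal.exists_nnreal_pos_mul_lt hh_int hε4
  let r : ℕ → ℝ≥0∞ := fun n => ((n : ℝ≥0∞) + 1)⁻¹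
  let U : ℕ → Set E := fun n => {x | ∃ y, edist x y < r n ∧ (c : ℝ≥0∞) < edist (f x) (f y)}
  have hU_open : ∀ n, IsOpen (U n) := fun n => by
    have : U n = ⋃ y, {x | edist x y < r n} ∩ {x | (c : ℝ≥0∞) < edist (f x) (f y)} := by
      ext x; simp [U]
    rw [this]
    exact isOpen_iUnion fun y => (isOpen_lt (by fun_prop) continuous_const).inter
      (isOpen_lt continuous_const (by fun_prop))
  have hU_lim : Tendsto (fun n => ∫⁻ x, (U n).indicator h x ∂μ) atTop (nhds 0) := by
    rw [← lintegral_zero (μ := μ)]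
    refine tendsto_lintegral_of_dominated_convergence h
      (fun n => hh.indicator (hU_open n).measurableSet)
      (fun n => .of_forall fun x => Set.indicator_le_self _ _ x) hh_int (.of_forall fun x => ?_)
    obtain ⟨δ, hδ, hball⟩ := EMetric.continuousAt_iff.1 (hf.continuousAt (x := x)) c
      (ENNReal.coe_pos.2 hc)
    have hr : Tendsto r atTop (nhds 0) := by
      have := ENNReal.tendsto_inv_nat_nhds_zero.comp (tendsto_add_atTop_nat 1)
      simpa [Function.comp_def, r] using this
    refine tendsto_const_nhds.congr' ?_
    filter_upwards [hr.eventually_lt_const hδ] with n hn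
    rw [Set.indicator_of_notMem]
    rintro ⟨y, hy, hcy⟩
    have := hball (x := y) (by rw [edist_comm]; exact hy.trans hn)
    rw [edist_comm] at this
    exact lt_asymm this hcy
  have htail : Tendsto (fun n : ℕ => ∫⁻ x, (h x - n) ∂μ) atTop (nhds 0) := by
    rw [← lintegral_zero (μ := μ)]
    refine tendsto_lintegral_of_dominated_convergence h (fun n => hh.sub_const _)
      (fun n => .of_forall fun x => tsub_le_self) hh_int (.of_forall fun x => ?_)
    obtain ⟨N, hN⟩ := ENNReal.exists_nat_gt (hh_top x)
    refine tendsto_const_nhds.congr' ?_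
    filter_upwards [eventually_ge_atTop N] with n hn
    rw [tsub_eq_zero_of_le (hN.le.trans (by exact_mod_cast hn))]
  obtain ⟨n, hn⟩ := ((ENNReal.tendsto_nhds_zero.1 hU_lim) _ (pos_iff_ne_zero.2 hε4)).exists
  obtain ⟨N, hN⟩ := ((ENNReal.tendsto_nhds_zero.1 htail) _ (pos_iff_ne_zero.2 hε4)).exists
  have hfar : Tendsto (fun k => (N : ℝ≥0∞) * π k {p | r n ≤ edist p.1 p.2}) atTop (nhds 0) := by
    have := ENNReal.Tendsto.const_mul (a := (N : ℝ≥0∞))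
      (hπ_diag (r n) (by simp [r]) (by simp [r])) (.inr (by simp))
    simpa using this
  filter_upwards [(ENNReal.tendsto_nhds_zero.1 hfar) _ (pos_iff_ne_zero.2 hε4)] with k hk
  let S : Set (E × E) := {p | r n ≤ edist p.1 p.2}
  have hS : MeasurableSet S := measurableSet_le measurable_const measurable_edist
  have hpt : ∀ p : E × E, h p.1 * edist (f p.1) (f p.2) ≤
      c * h p.1 + (U n).indicator h p.1 + (h p.1 - N) + S.indicator (fun _ => (N : ℝ≥0∞)) p := by
    intro p
    have hle : h p.1 * edist (f p.1) (f p.2) ≤ h p.1 := mul_le_of_le_one_right' (hf_le _ _)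
    by_cases hpS : p ∈ S
    · rw [Set.indicator_of_mem hpS, add_assoc]
      exact hle.trans (le_tsub_add.trans le_add_self)
    · by_cases hpU : p.1 ∈ U n
      · rw [Set.indicator_of_mem hpU, add_assoc, add_right_comm]
        exact hle.trans le_add_self
      · have hlt : edist p.1 p.2 < r n := not_le.1 hpS
        have hc' : edist (f p.1) (f p.2) ≤ c := not_lt.1 fun hlt' => hpU ⟨p.2, hlt, hlt'⟩
        rw [add_assoc, add_assoc]
        refine le_trans ?_ le_self_add
        rw [mul_comm]
        gcongr
  have hmarg : ∀ g : E → ℝ≥0∞, Measurable g → ∫⁻ p, g p.1 ∂(π k) = ∫⁻ x, g x ∂μ := by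
    intro g hg
    rw [← hπ k, lintegral_map hg measurable_fst]
  calc ∫⁻ p, h p.1 * edist (f p.1) (f p.2) ∂(π k)
      ≤ ∫⁻ p, (c * h p.1 + (U n).indicator h p.1 + (h p.1 - N) +
          S.indicator (fun _ => (N : ℝ≥0∞)) p) ∂(π k) := lintegral_mono hpt
    _ = c * ∫⁻ x, h x ∂μ + ∫⁻ x, (U n).indicator h x ∂μ + ∫⁻ x, (h x - N) ∂μ +
          N * π k S := by
        rw [lintegral_add_right _ (measurable_const.indicator hS),
          lintegral_add_right _ (by fun_prop),
          lintegral_add_left (by fun_prop),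
          lintegral_const_mul _ (by fun_prop), lintegral_indicator_const hS,
          hmarg h hh, hmarg _ (hh.indicator (hU_open n).measurableSet),
          hmarg _ (hh.sub_const _)]
    _ ≤ ε / 4 + ε / 4 + ε / 4 + ε / 4 := by
        gcongr
    _ = ε := by
        rw [← ENNReal.add_div, ← ENNReal.add_div, ← ENNReal.add_div]
        rw [show ε + ε + ε + ε = ε * 4 by ring]
        exact ENNReal.mul_div_cancel_right (by norm_num) (by norm_num)

lemma ofReal_le_ofReal_add_edist (a b : ℝ) :
    ENNReal.ofReal a ≤ ENNReal.ofReal b + edist a b := by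
  rw [edist_dist, Real.dist_eq]
  refine (ENNReal.ofReal_le_ofReal ?_).trans ENNReal.ofReal_add_le
  linarith [le_abs_self (a - b)]

lemma posterior_eq_withDensity {E : Type*} [MeasurableSpace E] (μ : Measure E) {Φ : E → ℝ}
    (hΦ : Measurable Φ) :
    posterior μ Φ = μ.withDensity fun x =>
      (∫⁻ x, ENNReal.ofReal (Real.exp (-Φ x)) ∂μ)⁻¹ * ENNReal.ofReal (Real.exp (-Φ x)) := by
  rw [posterior, ← withDensity_smul _ (by fun_prop)]
  rfl

lemma lintegral_exp_neg_ne_zero {E : Type*} [MeasurableSpace E] {μ : Measure E} (hμ : μ ≠ 0)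
    {Φ : E → ℝ} (hΦ : Measurable Φ) :
    ∫⁻ x, ENNReal.ofReal (Real.exp (-Φ x)) ∂μ ≠ 0 := by
  rw [Ne, lintegral_eq_zero_iff (by fun_prop)]
  intro h
  refine hμ (ae_eq_bot.1 (eventually_false_iff_eq_bot.1 ?_))
  filter_upwards [h] with x hx
  exact (Real.exp_pos (-Φ x)).not_ge (ENNReal.ofReal_eq_zero.1 hx)

lemma lintegral_exp_neg_ne_top {E : Type*} [MeasurableSpace E] {μ : Measure E}
    [IsProbabilityMeasure μ] {Φ : E → ℝ} (hΦ : ∀ x, 0 ≤ Φ x) :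
    ∫⁻ x, ENNReal.ofReal (Real.exp (-Φ x)) ∂μ ≠ ⊤ := by
  refine ne_top_of_le_ne_top one_ne_top ?_
  calc ∫⁻ x, ENNReal.ofReal (Real.exp (-Φ x)) ∂μ ≤ ∫⁻ _, 1 ∂μ := lintegral_mono fun x => by
        simpa using hΦ x
    _ = 1 := by simp

/-- Up to an arbitrarily small error, the Wasserstein distance is attained by a coupling. -/
lemma exists_coupling_lintegral_le {E : Type*} [EDist E] [MeasurableSpace E] {q : ℝ} (hq : 0 < q)
    (μ ν : Measure E) [IsProbabilityMeasure μ] [IsProbabilityMeasure ν] {ε : ℝ≥0∞} (hε : ε ≠ 0) :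
    ∃ π : Measure (E × E), π.map Prod.fst = μ ∧ π.map Prod.snd = ν ∧
      ∫⁻ p, edist p.1 p.2 ^ q ∂π ≤ (wassersteinDist q μ ν + ε) ^ q := by
  rcases eq_or_ne (wassersteinDist q μ ν) ⊤ with htop | htop
  · refine ⟨μ.prod ν, by simp [Measure.map_fst_prod], by simp [Measure.map_snd_prod], ?_⟩
    simp [htop, hq]
  · have hlt := ENNReal.lt_add_right htop hε
    conv_lhs at hlt => rw [wassersteinDist]
    simp only [iInf_lt_iff] at hlt
    obtain ⟨π, hfst, hsnd, hπ⟩ := hlt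
    refine ⟨π, hfst, hsnd, ?_⟩
    rw [one_div] at hπ
    exact (ENNReal.rpow_inv_le_iff hq).1 hπ.le

theorem wasserstein_continuity_prior
    {E : Type*} [MetricSpace E] [CompleteSpace E] [TopologicalSpace.SeparableSpace E]
    [MeasurableSpace E] [BorelSpace E]
    (q : ℝ) (hq : 1 ≤ q)
    (Φ : E → ℝ) (hΦcont : Continuous Φ) (hΦpos : ∀ x, 0 ≤ Φ x)
    (μ : Measure E) [IsProbabilityMeasure μ] (hμPq : ePnorm q μ < ⊤)
    (μt : ℕ → Measure E) (hμt : ∀ k, IsProbabilityMeasure (μt k))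
    (hμtPq : ∀ k, ePnorm q (μt k) < ⊤)
    (hconv : Tendsto (fun k => wassersteinDist q μ (μt k)) atTop (nhds 0)) :
    Tendsto (fun k => wassersteinDist q (posterior μ Φ) (posterior (μt k) Φ)) atTop
      (nhds 0) := by
  have : SecondCountableTopology E := UniformSpace.secondCountable_of_separable E
  have hq0 : 0 < q := by linarith
  have hΦm : Measurable Φ := hΦcont.measurable
  let f : E → ℝ := fun x => Real.exp (-Φ x)
  let F : E → ℝ≥0∞ := fun x => ENNReal.ofReal (f x)
  have hf : Continuous f := by fun_prop
  have hF : Measurable F := by fun_prop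
  have hf_pos : ∀ x, 0 ≤ f x := fun x => (Real.exp_pos _).le
  have hf_le : ∀ x, f x ≤ 1 := fun x => by simpa [f] using hΦpos x
  have hF_le : ∀ x, F x ≤ 1 := fun x => by simpa [F] using hf_le x
  have hf_edist : ∀ x y, edist (f x) (f y) ≤ 1 := fun x y => by
    rw [edist_dist, Real.dist_eq, ENNReal.ofReal_le_one, abs_le]
    constructor <;> linarith [hf_pos x, hf_pos y, hf_le x, hf_le y]
  have hF_sub : ∀ x y, F x - F y ≤ edist (f x) (f y) := fun x y =>
    tsub_le_iff_left.2 (ofReal_le_ofReal_add_edist _ _)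
  obtain ⟨x₀, hx₀⟩ : ∃ x₀ : E, ∫⁻ x, edist x x₀ ^ q ∂μ ≠ ⊤ := by
    obtain ⟨x₀, hx₀⟩ := iInf_lt_iff.1 hμPq
    exact ⟨x₀, fun h => by simp [h, hq0] at hx₀⟩
  choose π hπ_fst hπ_snd hπ_le using fun k : ℕ =>
    exists_coupling_lintegral_le hq0 μ (μt k) (ε := ((k : ℝ≥0∞) + 1)⁻¹) (by simp)
  let I : ℕ → ℝ≥0∞ := fun k => ∫⁻ p, edist p.1 p.2 ^ q ∂(π k)
  have hI : Tendsto I atTop (nhds 0) := by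
    have hinv : Tendsto (fun k : ℕ => ((k : ℝ≥0∞) + 1)⁻¹) atTop (nhds 0) := by
      simpa [Function.comp_def] using
        ENNReal.tendsto_inv_nat_nhds_zero.comp (tendsto_add_atTop_nat 1)
    have hub := (ENNReal.continuous_rpow_const (y := q)).tendsto 0 |>.comp
      (by simpa using hconv.add hinv)
    rw [ENNReal.zero_rpow_of_pos hq0] at hub
    exact tendsto_of_tendsto_of_tendsto_of_le_of_le tendsto_const_nhds hub
      (fun _ => zero_le) hπ_le
  have hπ_diag : ∀ δ : ℝ≥0∞, δ ≠ 0 → δ ≠ ⊤ →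
      Tendsto (fun k => π k {p | δ ≤ edist p.1 p.2}) atTop (nhds 0) := by
    intro δ hδ0 hδt
    have hδq0 : δ ^ q ≠ 0 := by simp [hδ0, hδt]
    have hub : Tendsto (fun k => I k / δ ^ q) atTop (nhds 0) := by
      simpa using ENNReal.Tendsto.div_const hI (.inr hδq0)
    refine tendsto_of_tendsto_of_tendsto_of_le_of_le tendsto_const_nhds hub (fun _ => zero_le)
      fun k => ?_
    refine le_trans (measure_mono fun p (hp : δ ≤ edist p.1 p.2) => ?_)
      (meas_ge_le_lintegral_div (f := fun p : E × E => edist p.1 p.2 ^ q) (by fun_prop) hδq0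
        (ENNReal.rpow_ne_top_of_nonneg hq0.le hδt))
    exact ENNReal.rpow_le_rpow hp hq0.le
  let J : ℕ → ℝ≥0∞ := fun k => ∫⁻ p, edist (f p.1) (f p.2) ∂(π k)
  let A : ℕ → ℝ≥0∞ := fun k => ∫⁻ p, edist p.1 x₀ ^ q * edist (f p.1) (f p.2) ∂(π k)
  have hJ : Tendsto J atTop (nhds 0) := by
    simpa using tendsto_lintegral_mul_edist_comp (μ := μ) (h := fun _ => 1) hf hf_edist
      measurable_const (by simp) (by simp) hπ_fst hπ_diag
  have hA : Tendsto A atTop (nhds 0) :=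
    tendsto_lintegral_mul_edist_comp (μ := μ) (h := fun x => edist x x₀ ^ q) hf hf_edist
      (by fun_prop) hx₀ (fun x => ENNReal.rpow_ne_top_of_nonneg hq0.le (edist_ne_top _ _))
      hπ_fst hπ_diag
  let Z : ℝ≥0∞ := ∫⁻ x, F x ∂μ
  let Zt : ℕ → ℝ≥0∞ := fun k => ∫⁻ x, F x ∂(μt k)
  have hZ0 : Z ≠ 0 := lintegral_exp_neg_ne_zero (IsProbabilityMeasure.ne_zero μ) hΦm
  have hZt0 : ∀ k, Zt k ≠ 0 := fun k =>
    lintegral_exp_neg_ne_zero (IsProbabilityMeasure.ne_zero (μt k)) hΦm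
  have hZ_top : Z ≠ ⊤ := lintegral_exp_neg_ne_top hΦpos
  have hZt_top : ∀ k, Zt k ≠ ⊤ := fun k => lintegral_exp_neg_ne_top hΦpos
  have hZi_top : Z⁻¹ ≠ ⊤ := ENNReal.inv_ne_top.2 hZ0
  have hZ_eq : ∀ k, ∫⁻ p, F p.1 ∂(π k) = Z := fun k => by
    rw [← lintegral_map hF measurable_fst, hπ_fst]
  have hZt_eq : ∀ k, ∫⁻ p, F p.2 ∂(π k) = Zt k := fun k => by
    rw [← lintegral_map hF measurable_snd, hπ_snd]
  have hZt_lim : Tendsto Zt atTop (nhds Z) := by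
    have hlow : Tendsto (fun k => Z - J k) atTop (nhds Z) := by
      simpa using ENNReal.Tendsto.sub (tendsto_const_nhds (x := Z)) hJ (.inl hZ_top)
    have hupp : Tendsto (fun k => Z + J k) atTop (nhds Z) := by
      simpa using (tendsto_const_nhds (x := Z)).add hJ
    refine tendsto_of_tendsto_of_tendsto_of_le_of_le hlow hupp (fun k => ?_) fun k => ?_
    · refine tsub_le_iff_right.2 ?_
      rw [← hZ_eq k, ← hZt_eq k, ← lintegral_add_left (by fun_prop)]
      exact lintegral_mono fun p => ofReal_le_ofReal_add_edist _ _
    · simp only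
      rw [← hZ_eq k, ← hZt_eq k, ← lintegral_add_left (by fun_prop)]
      exact lintegral_mono fun p => by
        rw [edist_comm]
        exact ofReal_le_ofReal_add_edist _ _
  have hZti_lim : Tendsto (fun k => (Zt k)⁻¹) atTop (nhds Z⁻¹) := tendsto_inv_iff.2 hZt_lim
  let r : ℕ → ℝ≥0∞ := fun k => Z⁻¹ - (Zt k)⁻¹
  let s : ℕ → ℝ≥0∞ := fun k => (Zt k)⁻¹ - Z⁻¹
  have hr : Tendsto r atTop (nhds 0) := by
    simpa using ENNReal.Tendsto.sub (tendsto_const_nhds (x := Z⁻¹)) hZti_lim (.inl hZi_top)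
  have hs : Tendsto s atTop (nhds 0) := by
    simpa using ENNReal.Tendsto.sub hZti_lim (tendsto_const_nhds (x := Z⁻¹)) (.inl hZi_top)
  have hab : ∀ k x y, Z⁻¹ * F x - (Zt k)⁻¹ * F y ≤ Z⁻¹ * edist (f x) (f y) + r k := by
    intro k x y
    refine (tsub_le_tsub_add_tsub (b := Z⁻¹ * F y)).trans (add_le_add ?_ ?_)
    · rw [← ENNReal.mul_sub fun _ _ => hZi_top]
      gcongr
      exact hF_sub x y
    · rw [← ENNReal.sub_mul fun _ _ => ENNReal.ofReal_ne_top]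
      exact mul_le_of_le_one_right' (hF_le y)
  have hba : ∀ k x y, (Zt k)⁻¹ * F y - Z⁻¹ * F x ≤ Z⁻¹ * edist (f x) (f y) + s k := by
    intro k x y
    rw [add_comm]
    refine (tsub_le_tsub_add_tsub (b := Z⁻¹ * F y)).trans (add_le_add ?_ ?_)
    · rw [← ENNReal.sub_mul fun _ _ => ENNReal.ofReal_ne_top]
      exact mul_le_of_le_one_right' (hF_le y)
    · rw [← ENNReal.mul_sub fun _ _ => hZi_top, edist_comm]
      gcongr
      exact hF_sub y x
  let M : ℝ≥0∞ := ∫⁻ x, edist x x₀ ^ q ∂μ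
  have hM_eq : ∀ k, ∫⁻ p, edist p.1 x₀ ^ q ∂(π k) = M := fun k => by
    rw [← lintegral_map (f := fun x : E => edist x x₀ ^ q) (by fun_prop) measurable_fst, hπ_fst]
  let C : ℝ≥0∞ := 2 ^ (q - 1)
  have hC : C ≠ ⊤ := ENNReal.rpow_ne_top_of_nonneg (by linarith) (by norm_num)
  have hweight : ∀ (k : ℕ) (t : ℝ≥0∞),
      ∫⁻ p, edist p.1 x₀ ^ q * (Z⁻¹ * edist (f p.1) (f p.2) + t) ∂(π k) =
        Z⁻¹ * A k + t * M := by
    intro k t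
    rw [← hM_eq k, ← lintegral_const_mul _ (by fun_prop), ← lintegral_const_mul _ (by fun_prop),
      ← lintegral_add_left (by fun_prop)]
    exact lintegral_congr fun p => by ring
  have hbound : ∀ k, wassersteinDist q (posterior μ Φ) (posterior (μt k) Φ) ^ q ≤
      I k * Z⁻¹ + C * ((Z⁻¹ * A k + r k * M) +
        C * (I k * (Z⁻¹ + s k) + (Z⁻¹ * A k + s k * M))) := by
    intro k
    have hW := wassersteinDist_withDensity_rpow_le hq (π := π k) (a := fun x => Z⁻¹ * F x)
      (b := fun x => (Zt k)⁻¹ * F x) (by fun_prop) (by fun_prop)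
      (by rw [lintegral_const_mul _ (by fun_prop), hZ_eq, ENNReal.inv_mul_cancel hZ0 hZ_top])
      (by rw [lintegral_const_mul _ (by fun_prop), hZt_eq,
            ENNReal.inv_mul_cancel (hZt0 k) (hZt_top k)]) x₀
    rw [hπ_fst, hπ_snd] at hW
    rw [posterior_eq_withDensity μ hΦm, posterior_eq_withDensity (μt k) hΦm]
    refine hW.trans (add_le_add ?_ (mul_le_mul_right (add_le_add ?_ ?_) C))
    · rw [← lintegral_mul_const _ (by fun_prop)]
      gcongr with p
      exact mul_le_of_le_one_right' (hF_le _)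
    · rw [← hweight]
      gcongr with p
      exact hab k _ _
    · rw [← hweight, ← lintegral_mul_const _ (by fun_prop), ← lintegral_add_left (by fun_prop),
        ← lintegral_const_mul _ (by fun_prop)]
      refine lintegral_mono fun p => ?_
      have htri : edist p.2 x₀ ^ q ≤ C * (edist p.1 p.2 ^ q + edist p.1 x₀ ^ q) :=
        (ENNReal.rpow_le_rpow (edist_triangle_left p.2 x₀ p.1) hq0.le).trans
          (ENNReal.rpow_add_le_mul_rpow_add_rpow _ _ hq)
      calc edist p.2 x₀ ^ q * ((Zt k)⁻¹ * F p.2 - Z⁻¹ * F p.1)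
          ≤ C * (edist p.1 p.2 ^ q + edist p.1 x₀ ^ q) *
              (Z⁻¹ * edist (f p.1) (f p.2) + s k) := mul_le_mul' htri (hba k _ _)
        _ = C * (edist p.1 p.2 ^ q * (Z⁻¹ * edist (f p.1) (f p.2) + s k) +
              edist p.1 x₀ ^ q * (Z⁻¹ * edist (f p.1) (f p.2) + s k)) := by ring
        _ ≤ _ := by
            gcongr
            exact mul_le_of_le_one_right' (hf_edist _ _)
  have hlim : Tendsto (fun k => I k * Z⁻¹ + C * ((Z⁻¹ * A k + r k * M) +
      C * (I k * (Z⁻¹ + s k) + (Z⁻¹ * A k + s k * M)))) atTop (nhds 0) := by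
    have hIZ : Tendsto (fun k => I k * Z⁻¹) atTop (nhds 0) := by
      simpa using ENNReal.Tendsto.mul_const hI (.inr hZi_top)
    have hZA : Tendsto (fun k => Z⁻¹ * A k) atTop (nhds 0) := by
      simpa using ENNReal.Tendsto.const_mul hA (.inr hZi_top)
    have hrM : Tendsto (fun k => r k * M) atTop (nhds 0) := by
      simpa using ENNReal.Tendsto.mul_const hr (.inr hx₀)
    have hsM : Tendsto (fun k => s k * M) atTop (nhds 0) := by
      simpa using ENNReal.Tendsto.mul_const hs (.inr hx₀)
    have hIs : Tendsto (fun k => I k * (Z⁻¹ + s k)) atTop (nhds 0) := by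
      simpa using ENNReal.Tendsto.mul hI (.inr (by simpa using hZ0))
        ((tendsto_const_nhds (x := Z⁻¹)).add hs) (.inr (by simp))
    have hinner := ENNReal.Tendsto.const_mul (hIs.add (hZA.add hsM)) (a := C) (.inr hC)
    have houter := ENNReal.Tendsto.const_mul ((hZA.add hrM).add hinner) (a := C) (.inr hC)
    simpa using hIZ.add houter
  have hpow := tendsto_of_tendsto_of_tendsto_of_le_of_le tendsto_const_nhds hlim
    (fun _ => zero_le) hbound
  have hroot := ((ENNReal.continuous_rpow_const (y := q⁻¹)).tendsto 0).comp hpow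
  rw [ENNReal.zero_rpow_of_pos (inv_pos.2 hq0)] at hroot
  simpa [Function.comp_def, ENNReal.rpow_rpow_inv hq0.ne'] using hroot
end
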